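/- Under the Nullstellensatz bijection between radical weighted-homogeneous relevant ideals and nonempty weighted projective varieties, prime weighted-homogeneous ideals correspond exactly to irreducible weighted projective varieties. -/

import Mathlib

open MvPolynomial

/-- The scaling equivalence on `𝔸^{n+1} ∖ {0}` defining weighted projective space:
`y ~ x` iff `y i = λ ^ (a i) * x i` for some unit `λ`. -/
def wpsRel {k : Type*} [Field k] {n : ℕ} (a : Fin (n + 1) → ℕ)
    (x y : {v : Fin (n + 1) → k // v ≠ 0}) : Prop :=
  ∃ l : kˣ, ∀ i, y.1 i = (l : k) ^ a i * x.1 i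

/-- Weighted projective space `ℙ(a_0, …, a_n)` as the quotient of
`𝔸^{n+1} ∖ {0}` by the weighted scaling action. -/
def WPS (k : Type*) [Field k] {n : ℕ} (a : Fin (n + 1) → ℕ) :=
  Quot (wpsRel (k := k) a)

/-- The vanishing locus in weighted projective space of an ideal. -/
def zeroLocus {k : Type*} [Field k] {n : ℕ} (a : Fin (n + 1) → ℕ)
    (I : Ideal (MvPolynomial (Fin (n + 1)) k)) : Set (WPS k a) :=
  {p | ∀ x : {v : Fin (n + 1) → k // v ≠ 0},
    Quot.mk (wpsRel a) x = p → ∀ f ∈ I, eval x.1 f = 0}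

/-- An ideal of the weighted polynomial ring is weighted-homogeneous if it can be
generated by weighted-homogeneous polynomials. -/
def IsWeightedHomogeneousIdeal {k : Type*} [Field k] {n : ℕ} (a : Fin (n + 1) → ℕ)
    (I : Ideal (MvPolynomial (Fin (n + 1)) k)) : Prop :=
  ∃ S : Set (MvPolynomial (Fin (n + 1)) k),
    (∀ g ∈ S, ∃ d : ℕ, g.IsWeightedHomogeneous a d) ∧ I = Ideal.span S

theorem wh_eval_scale {k : Type*} [Field k] {n : ℕ} (a : Fin (n + 1) → ℕ)
    {f : MvPolynomial (Fin (n + 1)) k} {d : ℕ} (hf : f.IsWeightedHomogeneous a d)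
    (l : k) (x : Fin (n + 1) → k) :
    eval (fun i => l ^ a i * x i) f = l ^ d * eval x f := by
  rw [eval_eq', eval_eq', Finset.mul_sum]
  refine Finset.sum_congr rfl fun m hm => ?_
  have h := hf (mem_support_iff.1 hm)
  rw [Finsupp.weight_apply, Finsupp.sum_fintype _ _ (by simp)] at h
  simp only [mul_pow, Finset.prod_mul_distrib, ← pow_mul]
  rw [Finset.prod_pow_eq_pow_sum, ← h]
  simp only [smul_eq_mul, mul_comm (a _)]
  ring

theorem wh_mem_iff {k : Type*} [Field k] {n : ℕ} (a : Fin (n + 1) → ℕ)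
    {J : Ideal (MvPolynomial (Fin (n + 1)) k)} (hJ : IsWeightedHomogeneousIdeal a J)
    (x : {v : Fin (n + 1) → k // v ≠ 0}) :
    (Quot.mk (wpsRel a) x : WPS k a) ∈ zeroLocus a J ↔ ∀ f ∈ J, eval x.1 f = 0 := by
  obtain ⟨S, hS, rfl⟩ := hJ
  have key : ∀ x : Fin (n + 1) → k,
      (∀ f ∈ Ideal.span S, eval x f = 0) ↔ ∀ f ∈ S, eval x f = 0 := by
    intro x
    have := Ideal.span_le (s := S) (I := RingHom.ker (eval x))
    exact this
  refine ⟨fun h => h x rfl, fun h y hy => ?_⟩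
  let P : WPS k a → Prop := Quot.lift
    (fun x : {v : Fin (n + 1) → k // v ≠ 0} => ∀ f ∈ Ideal.span S, eval x.1 f = 0) (by
      rintro u v ⟨l, hl⟩
      have hv : v.1 = fun i => (l : k) ^ a i * u.1 i := funext hl
      apply propext
      simp only [key]
      refine forall₂_congr fun f hf => ?_
      obtain ⟨d, hd⟩ := hS f hf
      rw [hv, wh_eval_scale a hd]
      simp)
  have e : P (Quot.mk _ y) = P (Quot.mk _ x) := congrArg P hy
  exact e.mpr h

theorem wh_null {k : Type*} [Field k] [IsAlgClosed k] {n : ℕ}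
    {I : Ideal (MvPolynomial (Fin (n + 1)) k)} (hrad : I.IsRadical)
    (f : MvPolynomial (Fin (n + 1)) k)
    (h : ∀ x : Fin (n + 1) → k, (∀ g ∈ I, eval x g = 0) → eval x f = 0) : f ∈ I := by
  rw [← hrad.radical, ← vanishingIdeal_zeroLocus_eq_radical (K := k) I]
  intro x hx
  rw [aeval_eq_eval]
  exact h x fun g hg => by simpa [aeval_eq_eval] using hx g hg

theorem wh_sup {k : Type*} [Field k] {n : ℕ} (a : Fin (n + 1) → ℕ)
    {I : Ideal (MvPolynomial (Fin (n + 1)) k)} (hI : IsWeightedHomogeneousIdeal a I)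
    {f : MvPolynomial (Fin (n + 1)) k} {d : ℕ} (hf : f.IsWeightedHomogeneous a d) :
    IsWeightedHomogeneousIdeal a (I ⊔ Ideal.span {f}) := by
  obtain ⟨S, hS, rfl⟩ := hI
  refine ⟨S ∪ {f}, ?_, (Ideal.span_union _ _).symm⟩
  rintro g (hg | rfl)
  · exact hS g hg
  · exact ⟨d, hf⟩

theorem wh_sup_eval {k : Type*} [Field k] {n : ℕ}
    {I : Ideal (MvPolynomial (Fin (n + 1)) k)} {f : MvPolynomial (Fin (n + 1)) k}
    (x : Fin (n + 1) → k) :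
    (∀ g ∈ I ⊔ Ideal.span {f}, eval x g = 0) ↔ (∀ g ∈ I, eval x g = 0) ∧ eval x f = 0 := by
  have h : I ⊔ Ideal.span {f} ≤ RingHom.ker (eval x) ↔
      I ≤ RingHom.ker (eval x) ∧ f ∈ RingHom.ker (eval x) := by
    rw [sup_le_iff, Ideal.span_singleton_le_iff_mem]
  exact h

theorem wh_ne {k : Type*} [Field k] [IsAlgClosed k] {n : ℕ}
    (a : Fin (n + 1) → ℕ) (ha : ∀ i, 0 < a i)
    {I : Ideal (MvPolynomial (Fin (n + 1)) k)}
    (hwh : IsWeightedHomogeneousIdeal a I) (hrad : I.IsRadical)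
    (hne : zeroLocus a I ≠ ∅)
    {f : MvPolynomial (Fin (n + 1)) k} {d : ℕ} (hf : f.IsWeightedHomogeneous a d)
    (hfI : f ∉ I) : zeroLocus a (I ⊔ Ideal.span {f}) ≠ zeroLocus a I := by
  intro heq
  apply hfI
  have hz : ∀ x : Fin (n + 1) → k, x ≠ 0 → (∀ g ∈ I, eval x g = 0) → eval x f = 0 := by
    intro x hx0 hx
    have h := (wh_mem_iff a hwh ⟨x, hx0⟩).2 hx
    rw [← heq, wh_mem_iff a (wh_sup a hwh hf), wh_sup_eval] at h
    exact h.2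
  apply wh_null hrad
  intro x hx
  by_cases hx0 : x = 0
  · obtain ⟨p, hp⟩ := Set.nonempty_iff_ne_empty.2 hne
    obtain ⟨y, rfl⟩ := Quot.exists_rep p
    have hy := hz y.1 y.2 ((wh_mem_iff a hwh y).1 hp)
    have hs := wh_eval_scale a hf 0 y.1
    rw [hy, mul_zero] at hs
    rw [hx0, ← hs]
    congr 2
    funext i
    simp [(ha i).ne']
  · exact hz x hx0 hx

theorem wh_exists {k : Type*} [Field k] {n : ℕ} (a : Fin (n + 1) → ℕ)
    {I J : Ideal (MvPolynomial (Fin (n + 1)) k)}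
    (hle : zeroLocus a J ⊆ zeroLocus a I) (hne : zeroLocus a J ≠ zeroLocus a I) :
    ∃ f ∈ J, f ∉ I := by
  by_contra! h
  refine hne (hle.antisymm fun p hp x hx f hf => hp x hx f (h f hf))

theorem prime_iff_irreducible_variety
    {k : Type*} [Field k] [IsAlgClosed k] {n : ℕ}
    (a : Fin (n + 1) → ℕ) (ha : ∀ i, 0 < a i)
    (I : Ideal (MvPolynomial (Fin (n + 1)) k))
    (hwh : IsWeightedHomogeneousIdeal a I) (hrad : I.IsRadical)
    (hrel : I < Ideal.span (Set.range (X : Fin (n + 1) → MvPolynomial (Fin (n + 1)) k)))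
    (hne : zeroLocus a I ≠ ∅) :
    I.IsPrime ↔
      ¬ ∃ J₁ J₂ : Ideal (MvPolynomial (Fin (n + 1)) k),
        IsWeightedHomogeneousIdeal a J₁ ∧ IsWeightedHomogeneousIdeal a J₂ ∧
        zeroLocus a I = zeroLocus a J₁ ∪ zeroLocus a J₂ ∧
        zeroLocus a J₁ ≠ ∅ ∧ zeroLocus a J₂ ≠ ∅ ∧
        zeroLocus a J₁ ≠ zeroLocus a I ∧ zeroLocus a J₂ ≠ zeroLocus a I := by
  constructor
  · rintro hp ⟨J₁, J₂, -, -, hU, -, -, h₁, h₂⟩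
    obtain ⟨f, hf, hfI⟩ := wh_exists a (hU ▸ Set.subset_union_left) h₁
    obtain ⟨g, hg, hgI⟩ := wh_exists a (hU ▸ Set.subset_union_right) h₂
    obtain ⟨i, hi⟩ : ∃ i, (X i : MvPolynomial (Fin (n + 1)) k) ∉ I := by
      by_contra! h
      exact hrel.not_ge (Ideal.span_le.2 (by rintro _ ⟨i, rfl⟩; exact h i))
    have hm : X i * (f * g) ∈ I := by
      apply wh_null hrad
      intro x hx
      by_cases hx0 : x = 0
      · simp [hx0]
      · have h := (wh_mem_iff a hwh ⟨x, hx0⟩).2 hx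
        rw [hU] at h
        rcases h with h | h
        · have := h ⟨x, hx0⟩ rfl f hf
          simp only at this
          simp [this]
        · have := h ⟨x, hx0⟩ rfl g hg
          simp only at this
          simp [this]
    rcases hp.mem_or_mem hm with h | h
    · exact hi h
    · rcases hp.mem_or_mem h with h | h
      · exact hfI h
      · exact hgI h
  · intro hirr
    let _ := weightedGradedAlgebra k a
    have hhom : I.IsHomogeneous (weightedHomogeneousSubmodule k a) := by
      obtain ⟨S, hS, rfl⟩ := hwh
      exact Ideal.homogeneous_span _ _ hS
    refine hhom.isPrime_of_homogeneous_mem_or_mem (hrel.trans_le le_top).ne ?_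
    rintro f g ⟨d, hf⟩ ⟨e, hg⟩ hfg
    by_contra! hnot
    rw [mem_weightedHomogeneousSubmodule] at hf hg
    have hU : zeroLocus a I =
        zeroLocus a (I ⊔ Ideal.span {f}) ∪ zeroLocus a (I ⊔ Ideal.span {g}) := by
      ext p
      obtain ⟨x, rfl⟩ := Quot.exists_rep p
      refine (wh_mem_iff a hwh x).trans (Iff.trans ?_
        (or_congr (wh_mem_iff a (wh_sup a hwh hf) x) (wh_mem_iff a (wh_sup a hwh hg) x)).symm)
      rw [wh_sup_eval, wh_sup_eval, ← and_or_left]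
      refine ⟨fun h => ⟨h, ?_⟩, fun h => h.1⟩
      have := h _ hfg
      rwa [map_mul, mul_eq_zero] at this
    have h₁ := wh_ne a ha hwh hrad hne hf hnot.1
    have h₂ := wh_ne a ha hwh hrad hne hg hnot.2
    refine hirr ⟨_, _, wh_sup a hwh hf, wh_sup a hwh hg, hU, ?_, ?_, h₁, h₂⟩
    · intro h
      rw [h, Set.empty_union] at hU
      exact h₂ hU.symm
    · intro h
      rw [h, Set.union_empty] at hU
      exact h₁ hU.symm
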